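/- The boundary of F in H²×H² equals the union ⋃_{g ∈ Γ, g ≠ 1} (F ∩ g(F)). -/

import Mathlib

noncomputable section

open scoped Classical
open MeasureTheory

namespace Hilbert

/-- `k₀ = 2` if `k ≡ 1 (mod 4)` and `k₀ = 1` otherwise. -/
def k0 (k : ℕ) : ℝ := if k % 4 = 1 then 2 else 1

/-- `ω = (1 + √k)/k₀`. -/
def omg (k : ℕ) : ℝ := (1 + Real.sqrt k) / k0 k

/-- `ω' = (1 - √k)/k₀`, the algebraic conjugate of `ω`. -/
def omg' (k : ℕ) : ℝ := (1 - Real.sqrt k) / k0 k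

/-- The ring `R = ℤ[ω]`, realized inside `ℝ × ℝ` via the pair of real embeddings
`α ↦ (α, α')` of `K = ℚ(√k)`. -/
def R (k : ℕ) : Subring (ℝ × ℝ) := Subring.closure {(omg k, omg' k)}

/-- The ambient space `ℝ⁴`, with coordinates `(x₁, x₂, y₁, y₂)`. -/
abbrev Pt : Type := ℝ × ℝ × ℝ × ℝ

def x1 (p : Pt) : ℝ := p.1
def x2 (p : Pt) : ℝ := p.2.1
def y1 (p : Pt) : ℝ := p.2.2.1
def y2 (p : Pt) : ℝ := p.2.2.2

/-- `H² × H²`, identified with an open subset of `ℝ⁴`. -/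
def HH : Set Pt := {p | 0 < y1 p ∧ 0 < y2 p}

/-- The coordinate `s₁`, determined by `x₁ = s₁ + s₂ ω`, `x₂ = s₁ + s₂ ω'`. -/
def s1 (k : ℕ) (p : Pt) : ℝ := (omg' k * x1 p - omg k * x2 p) / (omg' k - omg k)

/-- The coordinate `s₂`. -/
def s2 (k : ℕ) (p : Pt) : ℝ := (x1 p - x2 p) / (omg k - omg' k)

/-- The ratio `r = y₁/y₂`. -/
def rr (p : Pt) : ℝ := y1 p / y2 p

/-- The height `h = y₁ y₂`. -/
def hh (p : Pt) : ℝ := y1 p * y2 p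

/-- `‖cZ+d‖ = ((cx₁+d)² + c²y₁²)((c'x₂+d')² + c'²y₂²)`, where `c = (c, c')`, `d = (d, d')`
are given by their two real embeddings. -/
def HNorm (c d : ℝ × ℝ) (p : Pt) : ℝ :=
  ((c.1 * x1 p + d.1) ^ 2 + c.1 ^ 2 * y1 p ^ 2) *
    ((c.2 * x2 p + d.2) ^ 2 + c.2 ^ 2 * y2 p ^ 2)

/-- `S = {(c,d) ∈ R² : cR + dR = R}`. -/
def Spairs (k : ℕ) : Set (R k × R k) := {cd | Ideal.span {cd.1, cd.2} = ⊤}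

/-- `V_{c,d}^≥ = {Z ∈ H²×H² : ‖cZ+d‖ ≥ 1}`. -/
def Vge (k : ℕ) (cd : R k × R k) : Set Pt :=
  {p ∈ HH | 1 ≤ HNorm (cd.1 : ℝ × ℝ) (cd.2 : ℝ × ℝ) p}

/-- `V_{c,d}^≤ = {Z ∈ H²×H² : ‖cZ+d‖ ≤ 1}`. -/
def Vle (k : ℕ) (cd : R k × R k) : Set Pt :=
  {p ∈ HH | HNorm (cd.1 : ℝ × ℝ) (cd.2 : ℝ × ℝ) p ≤ 1}

/-- `V_{c,d} = {Z ∈ H²×H² : ‖cZ+d‖ = 1}`. -/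
def Veq (k : ℕ) (cd : R k × R k) : Set Pt :=
  {p ∈ HH | HNorm (cd.1 : ℝ × ℝ) (cd.2 : ℝ × ℝ) p = 1}

/-- `F₀ = {Z ∈ H²×H² : ‖cZ+d‖ ≥ 1 for all (c,d) ∈ S}`. -/
def F0 (k : ℕ) : Set Pt :=
  {p ∈ HH | ∀ cd ∈ Spairs k, 1 ≤ HNorm (cd.1 : ℝ × ℝ) (cd.2 : ℝ × ℝ) p}

/-- `F_∞ = {(s₁,s₂,r,h) : |s₁| ≤ 1/2, |s₂| ≤ 1/2, ε₀⁻² ≤ r ≤ ε₀²}`, where `ε` stands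
for the fundamental unit `ε₀`. -/
def FInf (k : ℕ) (ε : ℝ) : Set Pt :=
  {p ∈ HH | |s1 k p| ≤ 1 / 2 ∧ |s2 k p| ≤ 1 / 2 ∧ (ε ^ 2)⁻¹ ≤ rr p ∧ rr p ≤ ε ^ 2}

/-- `F = F_∞ ∩ F₀`. -/
def F (k : ℕ) (ε : ℝ) : Set Pt := FInf k ε ∩ F0 k

/-- `SL₂(R)`. -/
abbrev SL (k : ℕ) := Matrix.SpecialLinearGroup (Fin 2) (R k)

/-- Möbius action on the upper half-plane: image of `x + y i` under `(a b; c d)`. -/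
def moeb (a b c d x y : ℝ) : ℝ × ℝ :=
  (((a * x + b) * (c * x + d) + a * c * y ^ 2) / ((c * x + d) ^ 2 + c ^ 2 * y ^ 2),
    y / ((c * x + d) ^ 2 + c ^ 2 * y ^ 2))

/-- The action of `γ ∈ SL₂(R)` on `H²×H²`: `γ` acts on the first factor through the first
embedding and through the conjugate matrix `γ'` (second embedding) on the second factor.
This descends to the Hilbert modular group `PSL₂(R)`. -/
def act (k : ℕ) (g : SL k) (p : Pt) : Pt :=
  ((moeb (g.1 0 0 : ℝ × ℝ).1 (g.1 0 1 : ℝ × ℝ).1 (g.1 1 0 : ℝ × ℝ).1 (g.1 1 1 : ℝ × ℝ).1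
      (x1 p) (y1 p)).1,
   (moeb (g.1 0 0 : ℝ × ℝ).2 (g.1 0 1 : ℝ × ℝ).2 (g.1 1 0 : ℝ × ℝ).2 (g.1 1 1 : ℝ × ℝ).2
      (x2 p) (y2 p)).1,
   (moeb (g.1 0 0 : ℝ × ℝ).1 (g.1 0 1 : ℝ × ℝ).1 (g.1 1 0 : ℝ × ℝ).1 (g.1 1 1 : ℝ × ℝ).1
      (x1 p) (y1 p)).2,
   (moeb (g.1 0 0 : ℝ × ℝ).2 (g.1 0 1 : ℝ × ℝ).2 (g.1 1 0 : ℝ × ℝ).2 (g.1 1 1 : ℝ × ℝ).2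
      (x2 p) (y2 p)).2)

/-- The pair of real embeddings of a unit of `R`. -/
def unitVal (k : ℕ) (u : (R k)ˣ) : ℝ × ℝ := ((u : R k) : ℝ × ℝ)

/-- `e` is the fundamental unit of `R`: the smallest unit of `R` greater than `1`
(with respect to the first embedding). -/
def IsFundUnit (k : ℕ) (e : (R k)ˣ) : Prop :=
  1 < (unitVal k e).1 ∧
    ∀ v : (R k)ˣ, 1 < (unitVal k v).1 → (unitVal k e).1 ≤ (unitVal k v).1

/-- The real number `ε₀ > 1`, the fundamental unit under the first embedding. -/
def eps (k : ℕ) (e : (R k)ˣ) : ℝ := (unitVal k e).1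


/-- The norm `N(c) = c c'` of an element of `R` (as a real number). -/
def Nm (k : ℕ) (c : R k) : ℝ := ((c : ℝ × ℝ)).1 * ((c : ℝ × ℝ)).2

/-- A subset `C` of `H²×H²` is hyperbolically bounded if it is bounded in the
Euclidean metric and `y₁, y₂ > ε` on `C` for some `ε > 0`. -/
def HypBounded (C : Set Pt) : Prop :=
  C ⊆ HH ∧ Bornology.IsBounded C ∧ ∃ ε > (0 : ℝ), ∀ p ∈ C, ε < y1 p ∧ ε < y2 p

/-- `V_{C,μ} = {(c,d) ∈ R × R : ‖cZ+d‖ ≤ μ for some Z ∈ C}`. -/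
def VCmu (k : ℕ) (C : Set Pt) (μ : ℝ) : Set (R k × R k) :=
  {cd | ∃ p ∈ C, HNorm (cd.1 : ℝ × ℝ) (cd.2 : ℝ × ℝ) p ≤ μ}

/-- The conditions (8) of Theorem `FiniteSides` on a pair `(c,d) ∈ R²`. -/
def SCond (k : ℕ) (ε : ℝ) (cd : R k × R k) : Prop :=
  cd.1 ≠ 0 ∧ Ideal.span {cd.1, cd.2} = ⊤ ∧
    |Nm k cd.1| ≤ 2 * k / (k0 k) ^ 2 ∧
    |((cd.2 : ℝ × ℝ)).1 / ((cd.1 : ℝ × ℝ)).1| <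
      ε * Real.sqrt (2 * k / (Nm k cd.1 ^ 2 * (k0 k) ^ 2) - (k0 k) ^ 2 / (2 * k)) +
        (1 + omg k) / 2 ∧
    |((cd.2 : ℝ × ℝ)).2 / ((cd.1 : ℝ × ℝ)).2| <
      ε * Real.sqrt (2 * k / (Nm k cd.1 ^ 2 * (k0 k) ^ 2) - (k0 k) ^ 2 / (2 * k)) +
        (1 - omg' k) / 2

/-- `S₁` is a set of representatives, up to multiplication by units of `R`, of the pairs
`(c,d) ∈ R²` satisfying the conditions `SCond`. -/
def IsRepSet (k : ℕ) (ε : ℝ) (S1 : Set (R k × R k)) : Prop :=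
  (∀ cd ∈ S1, SCond k ε cd) ∧
    (∀ cd : R k × R k, SCond k ε cd →
      ∃ ab ∈ S1, ∃ u : (R k)ˣ, cd.1 = (u : R k) * ab.1 ∧ cd.2 = (u : R k) * ab.2) ∧
    (∀ ab ∈ S1, ∀ ab' ∈ S1,
      (∃ u : (R k)ˣ, ab'.1 = (u : R k) * ab.1 ∧ ab'.2 = (u : R k) * ab.2) → ab = ab')

/-- The family `𝒱_∞ = {V_i^± : i = 1,2,3}`. -/
def VfamInf (k : ℕ) (ε : ℝ) : Set (Set Pt) :=
  { {p ∈ HH | s1 k p = 1 / 2}, {p ∈ HH | s1 k p = -(1 / 2)},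
    {p ∈ HH | s2 k p = 1 / 2}, {p ∈ HH | s2 k p = -(1 / 2)},
    {p ∈ HH | rr p = ε ^ 2}, {p ∈ HH | rr p = (ε ^ 2)⁻¹} }

/-- The family `𝒱 = {V_{c,d} : (c,d) ∈ S, c ≠ 0}`. -/
def Vfam (k : ℕ) : Set (Set Pt) :=
  {V | ∃ cd ∈ Spairs k, cd.1 ≠ 0 ∧ V = Veq k cd}

/-- The family `𝓜 = {γ(M) : γ ∈ Γ, M ∈ 𝒱 ∪ 𝒱_∞}`. -/
def Mfam (k : ℕ) (ε : ℝ) : Set (Set Pt) :=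
  {M | ∃ g : SL k, ∃ V ∈ Vfam k ∪ VfamInf k ε, M = act k g '' V}

/-- `ω` as an element of `R`. -/
def omR (k : ℕ) : R k := ⟨(omg k, omg' k), Subring.subset_closure rfl⟩

/-- The side-pairing transformations: `γ ≠ 1` (in `PSL₂(R)`) such that `F ∩ γ⁻¹(F)` has
Hausdorff dimension `3`. -/
def SidePairings (k : ℕ) (ε : ℝ) : Set (SL k) :=
  {g | g ≠ 1 ∧ g.1 ≠ -1 ∧ dimH (F k ε ∩ act k g⁻¹ '' F k ε) = 3}


lemma k0_pos (k : ℕ) : 0 < k0 k := by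
  unfold k0; split_ifs <;> norm_num

lemma sqrt_pos' {k : ℕ} (hk1 : 1 < k) : 0 < Real.sqrt k :=
  Real.sqrt_pos.2 (by exact_mod_cast (by omega : 0 < k))

lemma om_diff {k : ℕ} (hk1 : 1 < k) : 0 < omg k - omg' k := by
  have h : omg k - omg' k = 2 * Real.sqrt k / k0 k := by unfold omg omg'; ring
  rw [h]; have := k0_pos k; have := sqrt_pos' hk1; positivity

lemma om_rel (k : ℕ) : ∃ t n : ℤ, omg k ^ 2 = t * omg k + n ∧ omg' k ^ 2 = t * omg' k + n ∧
    omg k + omg' k = t ∧ omg k * omg' k = -n := by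
  have hs : Real.sqrt k ^ 2 = k := Real.sq_sqrt (by positivity)
  by_cases h : k % 4 = 1
  · refine ⟨1, (k / 4 : ℕ), ?_⟩
    have hk : (k : ℝ) = 4 * ((k / 4 : ℕ) : ℝ) + 1 := by
      exact_mod_cast (by omega : k = 4 * (k / 4) + 1)
    have hn : ((k / 4 : ℕ) : ℝ) = (Real.sqrt k ^ 2 - 1) / 4 := by rw [hs]; linarith
    simp only [omg, omg', k0, h, if_true, Int.cast_natCast, Int.cast_one, hn]
    refine ⟨?_, ?_, ?_, ?_⟩ <;> ring
  · refine ⟨2, (k : ℤ) - 1, ?_⟩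
    have hn : (((k : ℤ) - 1 : ℤ) : ℝ) = Real.sqrt k ^ 2 - 1 := by rw [hs]; push_cast; ring
    simp only [omg, omg', k0, h, if_false, hn]
    refine ⟨?_, ?_, ?_, ?_⟩ <;> push_cast <;> ring

lemma R_rep {k : ℕ} (r : R k) : ∃ a b : ℤ, (r : ℝ × ℝ).1 = a + b * omg k ∧
    (r : ℝ × ℝ).2 = a + b * omg' k := by
  obtain ⟨x, hx⟩ := r
  obtain ⟨t, n, h1, h2, -, -⟩ := om_rel k
  change ∃ a b : ℤ, x.1 = a + b * omg k ∧ x.2 = a + b * omg' k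
  unfold R at hx
  induction hx using Subring.closure_induction with
  | mem x hx =>
    rw [Set.mem_singleton_iff] at hx; subst hx
    exact ⟨0, 1, by simp, by simp⟩
  | zero => exact ⟨0, 0, by simp, by simp⟩
  | one => exact ⟨1, 0, by simp, by simp⟩
  | add x y _ _ hx hy =>
    obtain ⟨a, b, ha, hb⟩ := hx
    obtain ⟨a', b', ha', hb'⟩ := hy
    refine ⟨a + a', b + b', ?_, ?_⟩
    · simp only [Prod.fst_add, ha, ha']; push_cast; ring
    · simp only [Prod.snd_add, hb, hb']; push_cast; ring
  | neg x _ hx =>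
    obtain ⟨a, b, ha, hb⟩ := hx
    refine ⟨-a, -b, ?_, ?_⟩
    · simp only [Prod.fst_neg, ha]; push_cast; ring
    · simp only [Prod.snd_neg, hb]; push_cast; ring
  | mul x y _ _ hx hy =>
    obtain ⟨a, b, ha, hb⟩ := hx
    obtain ⟨a', b', ha', hb'⟩ := hy
    refine ⟨a * a' + b * b' * n, a * b' + a' * b + b * b' * t, ?_, ?_⟩
    · simp only [Prod.fst_mul, ha, ha']; push_cast; linear_combination (b * b' : ℝ) * h1
    · simp only [Prod.snd_mul, hb, hb']; push_cast; linear_combination (b * b' : ℝ) * h2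

lemma R_mk (k : ℕ) (a b : ℤ) : ∃ r : R k, (r : ℝ × ℝ).1 = a + b * omg k ∧
    (r : ℝ × ℝ).2 = a + b * omg' k := by
  refine ⟨(a : R k) + (b : R k) * omR k, ?_, ?_⟩ <;> simp [omR]

lemma int_lin {k : ℕ} (hk : Squarefree k) (hk1 : 1 < k) (a b : ℤ)
    (h : (a : ℝ) + b * omg k = 0 ∨ (a : ℝ) + b * omg' k = 0) : a = 0 ∧ b = 0 := by
  have hirr : Irrational (Real.sqrt k) := by
    rw [irrational_sqrt_natCast_iff]
    rintro ⟨m, rfl⟩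
    have := hk m (dvd_refl _)
    rw [Nat.isUnit_iff] at this
    subst this; omega
  have hb : b = 0 := by
    by_contra hb
    have hb' : (b : ℝ) ≠ 0 := by exact_mod_cast hb
    have hkk : ∃ q : ℚ, (q : ℝ) = k0 k := by
      unfold k0; split_ifs
      · exact ⟨2, by simp⟩
      · exact ⟨1, by simp⟩
    obtain ⟨q, hq⟩ := hkk
    have hk0 := k0_pos k
    rcases h with h | h
    · apply hirr
      refine ⟨-(q * a / b) - 1, ?_⟩
      push_cast; rw [hq]
      unfold omg at h
      field_simp at h ⊢
      linarith
    · apply hirr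
      refine ⟨(q * a / b) + 1, ?_⟩
      push_cast; rw [hq]
      unfold omg' at h
      field_simp at h ⊢
      linarith
  subst hb
  refine ⟨?_, rfl⟩
  simpa using h

lemma R_inj {k : ℕ} (hk : Squarefree k) (hk1 : 1 < k) (r : R k)
    (h : (r : ℝ × ℝ).1 = 0 ∨ (r : ℝ × ℝ).2 = 0) : r = 0 := by
  obtain ⟨a, b, h1, h2⟩ := R_rep r
  rw [h1, h2] at h
  obtain ⟨rfl, rfl⟩ := int_lin hk hk1 a b h
  apply Subtype.ext
  apply Prod.ext
  · rw [h1]; simp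
  · rw [h2]; simp

lemma R_norm {k : ℕ} (r : R k) : ∃ n : ℤ, (r : ℝ × ℝ).1 * (r : ℝ × ℝ).2 = n := by
  obtain ⟨a, b, h1, h2⟩ := R_rep r
  obtain ⟨t, n, -, -, h3, h4⟩ := om_rel k
  refine ⟨a ^ 2 + a * b * t - b ^ 2 * n, ?_⟩
  rw [h1, h2]; push_cast
  linear_combination (a * b : ℝ) * h3 + (b ^ 2 : ℝ) * h4

lemma unit_mul_inv {k : ℕ} (u : (R k)ˣ) :
    (unitVal k u).1 * (unitVal k u⁻¹).1 = 1 ∧ (unitVal k u).2 * (unitVal k u⁻¹).2 = 1 := by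
  have h : ((u : R k) * ((u⁻¹ : (R k)ˣ) : R k) : R k) = 1 := Units.mul_inv u
  have h' := congrArg (fun r : R k => (r : ℝ × ℝ)) h
  exact ⟨congrArg Prod.fst h', congrArg Prod.snd h'⟩

lemma unit_norm {k : ℕ} (u : (R k)ˣ) : (unitVal k u).1 ^ 2 * (unitVal k u).2 ^ 2 = 1 := by
  obtain ⟨n, hn⟩ := R_norm (u : R k)
  obtain ⟨m, hm⟩ := R_norm ((u⁻¹ : (R k)ˣ) : R k)
  obtain ⟨h1, h2⟩ := unit_mul_inv u
  change (unitVal k u).1 * (unitVal k u).2 = n at hn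
  change (unitVal k u⁻¹).1 * (unitVal k u⁻¹).2 = m at hm
  have : (n : ℝ) * m = 1 := by
    rw [← hn, ← hm]; linear_combination (unitVal k u).2 * (unitVal k u⁻¹).2 * h1 + h2
  have h3 : n * m = 1 := by exact_mod_cast this
  have h4 : (n : ℝ) ^ 2 = 1 := by
    rcases Int.eq_one_or_neg_one_of_mul_eq_one h3 with h | h <;> rw [h] <;> norm_num
  rw [← mul_pow, hn, h4]

lemma unit_eq {k : ℕ} (hk : Squarefree k) (hk1 : 1 < k) (u : (R k)ˣ)
    (h : (unitVal k u).1 ^ 2 = 1) : (u : R k) = 1 ∨ (u : R k) = -1 := by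
  have h' : ((unitVal k u).1 - 1) * ((unitVal k u).1 + 1) = 0 := by linarith
  rcases mul_eq_zero.1 h' with h | h
  · left
    exact sub_eq_zero.1 (R_inj hk hk1 ((u : R k) - 1) (Or.inl (by simpa [unitVal] using h)))
  · right
    exact eq_neg_of_add_eq_zero_left
      (R_inj hk hk1 ((u : R k) + 1) (Or.inl (by simpa [unitVal] using h)))

lemma unit_big {k : ℕ} (hk : Squarefree k) (hk1 : 1 < k) (e : (R k)ˣ) (he : IsFundUnit k e)
    (u : (R k)ˣ) (h1 : (u : R k) ≠ 1) (h2 : (u : R k) ≠ -1) :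
    eps k e ^ 2 ≤ (unitVal k u).1 ^ 2 ∨ eps k e ^ 2 ≤ (unitVal k u).2 ^ 2 := by
  have key : ∀ v : (R k)ˣ, 1 < (unitVal k v).1 ^ 2 → eps k e ^ 2 ≤ (unitVal k v).1 ^ 2 := by
    intro v hv
    have h0 : 1 < eps k e := he.1
    have hneg : (unitVal k (-v)).1 = -(unitVal k v).1 := by simp [unitVal]
    rcases lt_or_ge 0 (unitVal k v).1 with h | h
    · have : 1 < (unitVal k v).1 := by nlinarith
      have : eps k e ≤ _ := he.2 v this
      nlinarith
    · have : 1 < (unitVal k (-v)).1 := by rw [hneg]; nlinarith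
      have : eps k e ≤ _ := he.2 _ this
      rw [hneg] at this
      nlinarith
  have hn := unit_norm u
  have hne : (unitVal k u).1 ^ 2 ≠ 1 := fun h => by
    rcases unit_eq hk hk1 u h with h | h
    · exact h1 h
    · exact h2 h
  rcases lt_or_gt_of_ne hne with h | h
  · right
    obtain ⟨h3, h4⟩ := unit_mul_inv u
    have h5 : (unitVal k u).1 ^ 2 * (unitVal k u⁻¹).1 ^ 2 = 1 := by rw [← mul_pow, h3]; norm_num
    have h6 : (unitVal k u).1 ^ 2 ≠ 0 := by intro h; rw [h] at hn; simp at hn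
    have h7 : (unitVal k u).2 ^ 2 = (unitVal k u⁻¹).1 ^ 2 :=
      mul_left_cancel₀ h6 (by rw [hn, h5])
    rw [h7]
    apply key
    nlinarith [sq_nonneg (unitVal k u⁻¹).1, sq_nonneg (unitVal k u).1]
  · left; exact key u h

lemma unit_zpow {k : ℕ} (e : (R k)ˣ) (n : ℤ) :
    (unitVal k (e ^ n)).1 = (unitVal k e).1 ^ n := by
  have h := map_zpow (Units.map (((RingHom.fst ℝ ℝ).comp (R k).subtype : R k →+* ℝ) : R k →* ℝ)) e n
  have h' := congrArg Units.val h
  rw [Units.val_zpow_eq_zpow_val] at h'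
  exact h'
lemma den_pos {a b c d x y : ℝ} (h : a * d - b * c = 1) (hy : 0 < y) :
    0 < (c * x + d) ^ 2 + c ^ 2 * y ^ 2 := by
  by_cases hc : c = 0
  · subst hc
    have : d ≠ 0 := by rintro rfl; simp at h
    simp only [zero_mul, zero_add]; positivity
  · positivity

lemma moeb_cpx {a b c d x y : ℝ} (h : a * d - b * c = 1) (hy : 0 < y) :
    (⟨(moeb a b c d x y).1, (moeb a b c d x y).2⟩ : ℂ) =
      (a * (⟨x, y⟩ : ℂ) + b) / (c * (⟨x, y⟩ : ℂ) + d) := by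
  have hD := den_pos (x := x) h hy
  have hne : (c * (⟨x, y⟩ : ℂ) + d) ≠ 0 := by
    intro h0
    have h1 := congrArg Complex.re h0
    have h2 := congrArg Complex.im h0
    simp at h1 h2
    rcases h2 with h2 | h2
    · subst h2; simp at h1; subst h1; simp at h
    · exact hy.ne' h2
  rw [eq_div_iff hne]
  have e1 : (moeb a b c d x y).1 * ((c * x + d) ^ 2 + c ^ 2 * y ^ 2) =
    (a * x + b) * (c * x + d) + a * c * y ^ 2 := div_mul_cancel₀ _ hD.ne'
  have e2 : (moeb a b c d x y).2 * ((c * x + d) ^ 2 + c ^ 2 * y ^ 2) = y :=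
    div_mul_cancel₀ _ hD.ne'
  apply Complex.ext
  · simp
    apply mul_right_cancel₀ hD.ne'
    linear_combination (c * x + d) * e1 - c * y * e2 + c * y ^ 2 * h
  · simp
    apply mul_right_cancel₀ hD.ne'
    linear_combination c * y * e1 + (c * x + d) * e2 - y * (c * x + d) * h

lemma moeb_comp {a b c d a' b' c' d' x y : ℝ} (h : a * d - b * c = 1)
    (h' : a' * d' - b' * c' = 1) (hy : 0 < y) :
    moeb (a * a' + b * c') (a * b' + b * d') (c * a' + d * c') (c * b' + d * d') x y =
      moeb a b c d (moeb a' b' c' d' x y).1 (moeb a' b' c' d' x y).2 := by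
  have hD' := den_pos (x := x) h' hy
  have hy' : 0 < (moeb a' b' c' d' x y).2 := div_pos hy hD'
  have hh : (a * a' + b * c') * (c * b' + d * d') - (a * b' + b * d') * (c * a' + d * c') = 1 := by
    linear_combination (a' * d' - b' * c') * h + h'
  have e1 := moeb_cpx (x := x) hh hy
  have e2 := moeb_cpx (x := (moeb a' b' c' d' x y).1) h hy'
  rw [moeb_cpx (x := x) h' hy] at e2
  have hne : ∀ {a b c d x y : ℝ}, a * d - b * c = 1 → 0 < y → (c * (⟨x, y⟩ : ℂ) + d) ≠ 0 := by
    intro a b c d x y h hy h0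
    have h1 := congrArg Complex.re h0
    have h2 := congrArg Complex.im h0
    simp at h1 h2
    rcases h2 with h2 | h2
    · subst h2; simp at h1; subst h1; simp at h
    · exact hy.ne' h2
  have n1 := hne (x := x) h' hy
  have n2 := hne (x := x) hh hy
  have key := e1.trans (b := _) (c := _) (show _ = (⟨(moeb a b c d (moeb a' b' c' d' x y).1 (moeb a' b' c' d' x y).2).1, (moeb a b c d (moeb a' b' c' d' x y).1 (moeb a' b' c' d' x y).2).2⟩ : ℂ) from by
    rw [e2]
    push_cast at n2 ⊢
    set z : ℂ := ⟨x, y⟩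
    have n3 : (c : ℂ) * ((a' * z + b') / (c' * z + d')) + d ≠ 0 := by
      intro h0
      apply n2
      have h1 : ((c : ℂ) * ((a' * z + b') / (c' * z + d')) + d) * (c' * z + d') =
          c * (a' * z + b') + d * (c' * z + d') := by
        rw [add_mul, mul_assoc, div_mul_cancel₀ _ n1]
      rw [h0, zero_mul] at h1
      linear_combination -h1
    rw [div_eq_div_iff n2 n3]
    field_simp
    ring)
  exact Prod.ext (congrArg Complex.re key) (congrArg Complex.im key)

lemma SL_det {k : ℕ} (g : SL k) :
    (g.1 0 0 : ℝ × ℝ).1 * (g.1 1 1 : ℝ × ℝ).1 - (g.1 0 1 : ℝ × ℝ).1 * (g.1 1 0 : ℝ × ℝ).1 = 1 ∧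
    (g.1 0 0 : ℝ × ℝ).2 * (g.1 1 1 : ℝ × ℝ).2 - (g.1 0 1 : ℝ × ℝ).2 * (g.1 1 0 : ℝ × ℝ).2 = 1 := by
  have h := g.2
  rw [Matrix.det_fin_two] at h
  have h' := congrArg (fun r : R k => (r : ℝ × ℝ)) h
  exact ⟨congrArg Prod.fst h', congrArg Prod.snd h'⟩

lemma act_HH {k : ℕ} (g : SL k) {p : Pt} (hp : p ∈ HH) : act k g p ∈ HH :=
  ⟨div_pos hp.1 (den_pos (SL_det g).1 hp.1), div_pos hp.2 (den_pos (SL_det g).2 hp.2)⟩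

lemma act_mul {k : ℕ} (g g' : SL k) {p : Pt} (hp : p ∈ HH) :
    act k (g * g') p = act k g (act k g' p) := by
  have h1 := moeb_comp (x := x1 p) (SL_det g).1 (SL_det g').1 hp.1
  have h2 := moeb_comp (x := x2 p) (SL_det g).2 (SL_det g').2 hp.2
  have hm : ∀ i j, (g * g').1 i j = g.1 i 0 * g'.1 0 j + g.1 i 1 * g'.1 1 j := by
    intro i j
    rw [Matrix.SpecialLinearGroup.coe_mul, Matrix.mul_apply, Fin.sum_univ_two]
  have f1 : ∀ i j, ((g * g').1 i j : ℝ × ℝ).1 = (g.1 i 0 : ℝ × ℝ).1 * (g'.1 0 j : ℝ × ℝ).1 +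
      (g.1 i 1 : ℝ × ℝ).1 * (g'.1 1 j : ℝ × ℝ).1 := by intro i j; rw [hm]; rfl
  have f2 : ∀ i j, ((g * g').1 i j : ℝ × ℝ).2 = (g.1 i 0 : ℝ × ℝ).2 * (g'.1 0 j : ℝ × ℝ).2 +
      (g.1 i 1 : ℝ × ℝ).2 * (g'.1 1 j : ℝ × ℝ).2 := by intro i j; rw [hm]; rfl
  unfold act
  simp only [f1, f2]
  rw [h1, h2]
  rfl

lemma act_one {k : ℕ} (p : Pt) : act k 1 p = p := by
  simp [act, moeb, x1, x2, y1, y2]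

lemma fac {a b c d x y : ℝ} (h : a * d - b * c = 1) (hy : 0 < y) (u v : ℝ) :
    ((u * (moeb a b c d x y).1 + v) ^ 2 + u ^ 2 * (moeb a b c d x y).2 ^ 2) *
      ((c * x + d) ^ 2 + c ^ 2 * y ^ 2) =
    ((u * a + v * c) * x + (u * b + v * d)) ^ 2 + (u * a + v * c) ^ 2 * y ^ 2 := by
  have hD := den_pos (x := x) h hy
  have e1 : (moeb a b c d x y).1 * ((c * x + d) ^ 2 + c ^ 2 * y ^ 2) =
    (a * x + b) * (c * x + d) + a * c * y ^ 2 := div_mul_cancel₀ _ hD.ne'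
  have e2 : (moeb a b c d x y).2 * ((c * x + d) ^ 2 + c ^ 2 * y ^ 2) = y :=
    div_mul_cancel₀ _ hD.ne'
  set X := (moeb a b c d x y).1
  set Y := (moeb a b c d x y).2
  have hN : ((a * x + b) * (c * x + d) + a * c * y ^ 2) ^ 2 + y ^ 2 =
      ((a * x + b) ^ 2 + a ^ 2 * y ^ 2) * ((c * x + d) ^ 2 + c ^ 2 * y ^ 2) := by
    linear_combination (-(y ^ 2) * (a * d - b * c + 1)) * h
  have e3 : (X ^ 2 + Y ^ 2) * ((c * x + d) ^ 2 + c ^ 2 * y ^ 2) =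
      (a * x + b) ^ 2 + a ^ 2 * y ^ 2 := by
    apply mul_right_cancel₀ hD.ne'
    rw [← hN, ← e1]
    linear_combination (Y * ((c * x + d) ^ 2 + c ^ 2 * y ^ 2) + y) * e2
  linear_combination u ^ 2 * e3 + 2 * u * v * e1

lemma HNorm_act {k : ℕ} (g : SL k) {p : Pt} (hp : p ∈ HH) (c d : R k) :
    HNorm (c : ℝ × ℝ) (d : ℝ × ℝ) (act k g p) *
      HNorm (g.1 1 0 : ℝ × ℝ) (g.1 1 1 : ℝ × ℝ) p =
    HNorm ((c * g.1 0 0 + d * g.1 1 0 : R k) : ℝ × ℝ)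
      ((c * g.1 0 1 + d * g.1 1 1 : R k) : ℝ × ℝ) p := by
  have h1 := fac (x := x1 p) (SL_det g).1 hp.1 (c : ℝ × ℝ).1 (d : ℝ × ℝ).1
  have h2 := fac (x := x2 p) (SL_det g).2 hp.2 (c : ℝ × ℝ).2 (d : ℝ × ℝ).2
  have h3 := congrArg₂ (· * ·) h1 h2
  refine Eq.trans ?_ h3
  unfold HNorm
  rw [mul_mul_mul_comm]
  rfl

lemma Spairs_iff {k : ℕ} (c d : R k) : (c, d) ∈ Spairs k ↔ ∃ a b : R k, a * c + b * d = 1 := by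
  change Ideal.span {c, d} = ⊤ ↔ _
  rw [Ideal.eq_top_iff_one, Ideal.mem_span_pair]

lemma Spairs_row {k : ℕ} (g : SL k) : (g.1 1 0, g.1 1 1) ∈ Spairs k := by
  rw [Spairs_iff]
  have h := g.2
  rw [Matrix.det_fin_two] at h
  exact ⟨-g.1 0 1, g.1 0 0, by linear_combination h⟩

lemma Spairs_mul {k : ℕ} (g : SL k) {c d : R k} (h : (c, d) ∈ Spairs k) :
    (c * g.1 0 0 + d * g.1 1 0, c * g.1 0 1 + d * g.1 1 1) ∈ Spairs k := by
  rw [Spairs_iff] at h ⊢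
  obtain ⟨a, b, hab⟩ := h
  have h := g.2
  rw [Matrix.det_fin_two] at h
  refine ⟨a * g.1 1 1 - b * g.1 0 1, b * g.1 0 0 - a * g.1 1 0, ?_⟩
  linear_combination (a * c + b * d) * h + hab

lemma act_F0 {k : ℕ} (g : SL k) {p : Pt} (hp : p ∈ F0 k)
    (h : HNorm (g.1 1 0 : ℝ × ℝ) (g.1 1 1 : ℝ × ℝ) p = 1) : act k g p ∈ F0 k := by
  refine ⟨act_HH g hp.1, ?_⟩
  rintro ⟨c, d⟩ hcd
  have h1 := HNorm_act g hp.1 c d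
  rw [h, mul_one] at h1
  have := hp.2 _ (Spairs_mul g hcd)
  change 1 ≤ HNorm (c : ℝ × ℝ) (d : ℝ × ℝ) (act k g p)
  rw [h1]; exact this

lemma HNorm_unit {k : ℕ} (d : (R k)ˣ) (p : Pt) : HNorm ((0 : R k) : ℝ × ℝ) ((d : R k) : ℝ × ℝ) p = 1 := by
  have := unit_norm d
  unfold unitVal at this
  simp [HNorm, this]

lemma HNorm_smul {k : ℕ} (u : (R k)ˣ) (c d : R k) (p : Pt) :
    HNorm (((u : R k) * c : R k) : ℝ × ℝ) (((u : R k) * d : R k) : ℝ × ℝ) p =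
      HNorm (c : ℝ × ℝ) (d : ℝ × ℝ) p := by
  have := unit_norm u
  unfold unitVal at this
  simp only [HNorm, Subring.coe_mul, Prod.fst_mul, Prod.snd_mul]
  set a := ((u : R k) : ℝ × ℝ).1
  set b := ((u : R k) : ℝ × ℝ).2
  set X := (c : ℝ × ℝ).1
  set Y := (d : ℝ × ℝ).1
  set X' := (c : ℝ × ℝ).2
  set Y' := (d : ℝ × ℝ).2
  linear_combination (((X * x1 p + Y) ^ 2 + X ^ 2 * y1 p ^ 2) *
    ((X' * x2 p + Y') ^ 2 + X' ^ 2 * y2 p ^ 2)) * this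

/-- upper triangular elements -/
lemma actU {k : ℕ} (d : (R k)ˣ) (β : R k) : ∃ t : SL k, t.1 1 0 = 0 ∧ t.1 1 1 = d ∧
    t.1 0 1 = d * β ∧ ∀ p, act k t p =
      (x1 p / (unitVal k d).1 ^ 2 + (β : ℝ × ℝ).1, x2 p / (unitVal k d).2 ^ 2 + (β : ℝ × ℝ).2,
        y1 p / (unitVal k d).1 ^ 2, y2 p / (unitVal k d).2 ^ 2) := by
  obtain ⟨h1, h2⟩ := unit_mul_inv d
  refine ⟨⟨!![((d⁻¹ : (R k)ˣ) : R k), d * β; 0, d], by simp [Matrix.det_fin_two]⟩, rfl, rfl, rfl, ?_⟩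
  intro p
  have n1 : (unitVal k d).1 ≠ 0 := left_ne_zero_of_mul_eq_one h1
  have n2 : (unitVal k d).2 ≠ 0 := left_ne_zero_of_mul_eq_one h2
  have i1 : (unitVal k d⁻¹).1 = 1 / (unitVal k d).1 := by rw [eq_div_iff n1]; linarith
  have i2 : (unitVal k d⁻¹).2 = 1 / (unitVal k d).2 := by rw [eq_div_iff n2]; linarith
  unfold unitVal at i1 i2 n1 n2
  simp only [act, moeb, unitVal, Matrix.of_apply, Matrix.cons_val_zero, Matrix.cons_val_one,
    Matrix.cons_val', Matrix.cons_val_fin_one,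
    Subring.coe_mul, Prod.fst_mul, Prod.snd_mul, i1, i2, Subring.coe_zero, Prod.fst_zero, Prod.snd_zero]
  refine Prod.ext ?_ (Prod.ext ?_ (Prod.ext ?_ ?_)) <;> simp only <;> field_simp <;> ring
lemma s_shift {k : ℕ} (hk1 : 1 < k) {p q : Pt} {a b : ℝ} (h1 : x1 q = x1 p + (a + b * omg k))
    (h2 : x2 q = x2 p + (a + b * omg' k)) : s1 k q = s1 k p + a ∧ s2 k q = s2 k p + b := by
  have h := om_diff hk1
  have h' : omg' k - omg k ≠ 0 := by intro h0; linarith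
  unfold s1 s2
  rw [h1, h2]
  constructor
  · rw [div_add' _ _ _ h']; congr 1; ring
  · rw [div_add' _ _ _ h.ne']; congr 1; ring

lemma cont_s1 (k : ℕ) : Continuous (s1 k) := by unfold s1 x1 x2; fun_prop
lemma cont_s2 (k : ℕ) : Continuous (s2 k) := by unfold s2 x1 x2; fun_prop
lemma cont_HNorm (c d : ℝ × ℝ) : Continuous (HNorm c d) := by
  unfold HNorm x1 x2 y1 y2; fun_prop
lemma cont_rr {p : Pt} (hp : p ∈ HH) : ContinuousAt rr p := by
  unfold rr y1 y2
  have : p.2.2.2 ≠ 0 := hp.2.ne'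
  fun_prop (disch := assumption)
lemma open_HH : IsOpen HH := by
  have h1 : Continuous y1 := by unfold y1; fun_prop
  have h2 : Continuous y2 := by unfold y2; fun_prop
  exact (isOpen_lt continuous_const h1).inter (isOpen_lt continuous_const h2)

lemma path_ev {s : Set Pt} {p : Pt} (hp : p ∈ interior s) (γ : ℝ → Pt) (hγ : Continuous γ)
    (h0 : γ 0 = p) : ∃ δ : ℝ, 0 < δ ∧ δ < 1 / 2 ∧ γ δ ∈ s ∧ γ (-δ) ∈ s := by
  have h1 : ∀ᶠ t in nhds (0 : ℝ), γ t ∈ s := by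
    apply hγ.continuousAt.eventually
    rw [h0]; exact mem_interior_iff_mem_nhds.1 hp
  rw [Metric.eventually_nhds_iff] at h1
  obtain ⟨η, hη, h⟩ := h1
  refine ⟨min (η / 2) (1 / 4), by positivity, ?_, ?_, ?_⟩
  · exact (min_le_right _ _).trans_lt (by norm_num)
  all_goals
    apply h
    rw [Real.dist_eq, sub_zero]
    try rw [abs_neg]
    rw [abs_of_pos (by positivity)]
    exact (min_le_left _ _).trans_lt (by linarith)

lemma not_int_s {k : ℕ} (hk1 : 1 < k) {ε : ℝ} {p : Pt}
    (h : |s1 k p| = 1 / 2 ∨ |s2 k p| = 1 / 2) : p ∉ interior (F k ε) := by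
  intro hp
  have aux : ∀ x δ : ℝ, 0 < δ → |x + δ| ≤ 1 / 2 → |x + -δ| ≤ 1 / 2 → |x| ≠ 1 / 2 := by
    intro x δ hδ h1 h2 h3
    rw [abs_le] at h1 h2
    rcases abs_cases x with h | h <;> linarith
  rcases h with h | h
  · obtain ⟨δ, h1, -, h2, h3⟩ := path_ev hp (fun t => (x1 p + t, x2 p + t, y1 p, y2 p))
      (by fun_prop) (by simp [x1, x2, y1, y2])
    have e : ∀ t : ℝ, s1 k (x1 p + t, x2 p + t, y1 p, y2 p) = s1 k p + t := fun t =>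
      (s_shift (a := t) (b := 0) hk1 (by simp [x1]) (by simp [x2])).1
    have a1 := h2.1.2.1
    have a2 := h3.1.2.1
    rw [e] at a1 a2
    exact aux _ _ h1 a1 a2 h
  · obtain ⟨δ, h1, -, h2, h3⟩ := path_ev hp
      (fun t => (x1 p + t * omg k, x2 p + t * omg' k, y1 p, y2 p))
      (by fun_prop) (by simp [x1, x2, y1, y2])
    have e : ∀ t : ℝ, s2 k (x1 p + t * omg k, x2 p + t * omg' k, y1 p, y2 p) = s2 k p + t :=
      fun t => (s_shift (a := 0) (b := t) hk1 (by simp [x1]) (by simp [x2])).2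
    have a1 := h2.1.2.2.1
    have a2 := h3.1.2.2.1
    rw [e] at a1 a2
    exact aux _ _ h1 a1 a2 h

lemma not_int_r {k : ℕ} {ε : ℝ} {p : Pt} (hpH : p ∈ HH)
    (h : rr p = ε ^ 2 ∨ rr p = (ε ^ 2)⁻¹) : p ∉ interior (F k ε) := by
  intro hp
  have hr : 0 < rr p := div_pos hpH.1 hpH.2
  obtain ⟨δ, h1, -, h2, h3⟩ := path_ev hp (fun t => (x1 p, x2 p, y1 p * (1 + t), y2 p))
      (by fun_prop) (by simp [x1, x2, y1, y2])
  have e : ∀ t : ℝ, rr (x1 p, x2 p, y1 p * (1 + t), y2 p) = rr p * (1 + t) := by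
    intro t; simp only [rr, y1, y2]; ring
  have a1 := h2.1.2.2.2
  have a2 := h3.1.2.2.2
  rw [e] at a1 a2
  rcases h with h | h
  · rw [← h] at a1; nlinarith [a1.2]
  · rw [← h] at a2; nlinarith [a2.1]

lemma not_int_n {k : ℕ} (hk : Squarefree k) (hk1 : 1 < k) {ε : ℝ} {p : Pt} (hpH : p ∈ HH)
    {c d : R k} (hc : c ≠ 0) (hcd : (c, d) ∈ Spairs k)
    (h : HNorm (c : ℝ × ℝ) (d : ℝ × ℝ) p ≤ 1) : p ∉ interior (F k ε) := by
  intro hp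
  obtain ⟨δ, h1, h1', -, h3⟩ := path_ev hp
      (fun t => (x1 p, x2 p, y1 p * (1 + t), y2 p * (1 + t)))
      (by fun_prop) (by simp [x1, x2, y1, y2])
  have h4 := h3.2.2 _ hcd
  have c1 : (c : ℝ × ℝ).1 ≠ 0 := fun h => hc (R_inj hk hk1 c (Or.inl h))
  have c2 : (c : ℝ × ℝ).2 ≠ 0 := fun h => hc (R_inj hk hk1 c (Or.inr h))
  have q1 := hpH.1
  have q2 := hpH.2
  refine absurd (h4.trans_lt ?_) (lt_irrefl 1)
  refine lt_of_lt_of_le ?_ h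
  have hδ : 0 < 1 + -δ := by linarith
  have hδ1 : (1 + -δ) ^ 2 < 1 := by nlinarith
  change (((c : ℝ × ℝ).1 * x1 p + (d : ℝ × ℝ).1) ^ 2 + (c : ℝ × ℝ).1 ^ 2 * (y1 p * (1 + -δ)) ^ 2) *
    (((c : ℝ × ℝ).2 * x2 p + (d : ℝ × ℝ).2) ^ 2 + (c : ℝ × ℝ).2 ^ 2 * (y2 p * (1 + -δ)) ^ 2) <
    (((c : ℝ × ℝ).1 * x1 p + (d : ℝ × ℝ).1) ^ 2 + (c : ℝ × ℝ).1 ^ 2 * (y1 p) ^ 2) *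
    (((c : ℝ × ℝ).2 * x2 p + (d : ℝ × ℝ).2) ^ 2 + (c : ℝ × ℝ).2 ^ 2 * (y2 p) ^ 2)
  have b1 : (c : ℝ × ℝ).1 ^ 2 * (y1 p * (1 + -δ)) ^ 2 < (c : ℝ × ℝ).1 ^ 2 * (y1 p) ^ 2 := by
    have : 0 < (c : ℝ × ℝ).1 ^ 2 * (y1 p) ^ 2 := by positivity
    rw [mul_pow, ← mul_assoc]; nlinarith
  have b2 : (c : ℝ × ℝ).2 ^ 2 * (y2 p * (1 + -δ)) ^ 2 < (c : ℝ × ℝ).2 ^ 2 * (y2 p) ^ 2 := by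
    have : 0 < (c : ℝ × ℝ).2 ^ 2 * (y2 p) ^ 2 := by positivity
    rw [mul_pow, ← mul_assoc]; nlinarith
  apply mul_lt_mul'' (by linarith) (by linarith) (by positivity) (by positivity)

lemma closed_F {k : ℕ} {ε : ℝ} {p : Pt} (hpH : p ∈ HH) (hp : p ∈ closure (F k ε)) :
    p ∈ F k ε := by
  rw [mem_closure_iff_nhdsWithin_neBot] at hp
  have key : ∀ f : Pt → ℝ, ContinuousAt f p → ∀ a, (∀ q ∈ F k ε, f q ≤ a) → f p ≤ a := by
    intro f hf a h
    exact le_of_tendsto (hf.tendsto.mono_left nhdsWithin_le_nhds)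
      (eventually_nhdsWithin_of_forall h)
  have key' : ∀ f : Pt → ℝ, ContinuousAt f p → ∀ a, (∀ q ∈ F k ε, a ≤ f q) → a ≤ f p := by
    intro f hf a h
    exact ge_of_tendsto (hf.tendsto.mono_left nhdsWithin_le_nhds)
      (eventually_nhdsWithin_of_forall h)
  refine ⟨⟨hpH, ?_, ?_, ?_, ?_⟩, hpH, ?_⟩
  · exact key (fun q => |s1 k q|) (cont_s1 k).abs.continuousAt _ fun q hq => hq.1.2.1
  · exact key (fun q => |s2 k q|) (cont_s2 k).abs.continuousAt _ fun q hq => hq.1.2.2.1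
  · exact key' _ (cont_rr hpH) _ fun q hq => hq.1.2.2.2.1
  · exact key _ (cont_rr hpH) _ fun q hq => hq.1.2.2.2.2
  · intro cd hcd
    exact key' _ (cont_HNorm _ _).continuousAt _ fun q hq => hq.2.2 _ hcd

lemma fin_R {k : ℕ} (hk1 : 1 < k) (C : ℝ) :
    {r : R k | |(r : ℝ × ℝ).1| ≤ C ∧ |(r : ℝ × ℝ).2| ≤ C}.Finite := by
  have hd := om_diff hk1
  set B := 2 * C / (omg k - omg' k) with hB
  set A := C + |B| * |omg k| with hA
  choose f hf using fun ab : ℤ × ℤ => R_mk k ab.1 ab.2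
  have hfin : (Set.Icc (-⌈A⌉) ⌈A⌉ ×ˢ Set.Icc (-⌈B⌉) ⌈B⌉ : Set (ℤ × ℤ)).Finite :=
    (Set.finite_Icc _ _).prod (Set.finite_Icc _ _)
  refine (hfin.image f).subset ?_
  rintro r ⟨h1, h2⟩
  obtain ⟨a, b, ha, hb⟩ := R_rep r
  have hbB : |(b : ℝ)| ≤ B := by
    rw [hB, le_div_iff₀ hd]
    have : (b : ℝ) * (omg k - omg' k) = (r : ℝ × ℝ).1 - (r : ℝ × ℝ).2 := by rw [ha, hb]; ring
    rw [← abs_of_pos hd, ← abs_mul, this]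
    calc _ ≤ |(r : ℝ × ℝ).1| + |(r : ℝ × ℝ).2| := abs_sub _ _
      _ ≤ _ := by linarith
  have haA : |(a : ℝ)| ≤ A := by
    have : (a : ℝ) = (r : ℝ × ℝ).1 - b * omg k := by rw [ha]; ring
    rw [this]
    calc _ ≤ |(r : ℝ × ℝ).1| + |b * omg k| := abs_sub _ _
      _ ≤ _ := by
        rw [abs_mul, hA]
        exact add_le_add h1 (mul_le_mul_of_nonneg_right (hbB.trans (le_abs_self B)) (abs_nonneg _))
  have toint : ∀ (n : ℤ) (X : ℝ), |(n : ℝ)| ≤ X → n ∈ Set.Icc (-⌈X⌉) ⌈X⌉ := by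
    intro n X h
    have h3 := abs_le.1 (h.trans (Int.le_ceil X))
    constructor
    · exact_mod_cast h3.1
    · exact_mod_cast h3.2
  refine ⟨(a, b), ⟨toint a A haA, toint b B hbB⟩, ?_⟩
  apply Subtype.ext
  apply Prod.ext
  · rw [(hf _).1, ha]
  · rw [(hf _).2, hb]

lemma bd {c d x y E m M : ℝ} (hm : 0 < m) (hy : m ≤ y) (hE : 0 < E) (hx : |x| ≤ M)
    (h : (c * x + d) ^ 2 + c ^ 2 * y ^ 2 ≤ E ^ 2) :
    |c| ≤ E / m + E + E / m * M ∧ |d| ≤ E / m + E + E / m * M := by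
  have hM : 0 ≤ M := (abs_nonneg x).trans hx
  have h1 : |c| ≤ E / m := by
    rw [le_div_iff₀ hm]
    have : |c| * m ≤ |c| * y := by gcongr
    refine this.trans ?_
    rw [← abs_of_pos hE, ← abs_of_pos (hm.trans_le hy), ← abs_mul]
    apply sq_le_sq.1
    nlinarith [sq_nonneg (c * x + d)]
  have h2 : |c * x + d| ≤ E := by
    rw [← abs_of_pos hE]
    apply sq_le_sq.1
    nlinarith [sq_nonneg (c * y)]
  have h3 : |d| ≤ |c * x + d| + |c * x| := by
    have : d = (c * x + d) - c * x := by ring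
    nth_rewrite 1 [this]; exact abs_sub _ _
  have h4 : |c * x| ≤ E / m * M := by rw [abs_mul]; gcongr
  have h5 : 0 < E / m := by positivity
  have h6 : 0 ≤ E / m * M := by positivity
  constructor <;> linarith

lemma Spairs_smul {k : ℕ} (v : (R k)ˣ) {c d : R k} (hcd : (c, d) ∈ Spairs k) :
    ((v : R k) * c, (v : R k) * d) ∈ Spairs k := by
  rw [Spairs_iff] at hcd ⊢
  obtain ⟨a, b, hab⟩ := hcd
  refine ⟨a * ((v⁻¹ : (R k)ˣ) : R k), b * ((v⁻¹ : (R k)ˣ) : R k), ?_⟩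
  have := Units.inv_mul v
  linear_combination (a * c + b * d) * this + hab

set_option maxHeartbeats 1000000 in
lemma interior_of_strict {k : ℕ} (hk : Squarefree k) (hk1 : 1 < k) (e : (R k)ˣ)
    (he : IsFundUnit k e) {p : Pt} (hp : p ∈ HH) (h1 : |s1 k p| < 1 / 2) (h2 : |s2 k p| < 1 / 2)
    (h3 : (eps k e ^ 2)⁻¹ < rr p) (h4 : rr p < eps k e ^ 2)
    (h5 : ∀ c d : R k, (c, d) ∈ Spairs k → c ≠ 0 → 1 < HNorm (c : ℝ × ℝ) (d : ℝ × ℝ) p) :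
    p ∈ interior (F k (eps k e)) := by
  rw [mem_interior_iff_mem_nhds]
  have hε : 1 < eps k e := he.1
  set m := min (y1 p) (y2 p) / 2 with hm
  have hm0 : 0 < m := by have := lt_min hp.1 hp.2; positivity
  set M := max |x1 p| |x2 p| + 1 with hM
  set C := eps k e / m + eps k e + eps k e / m * M with hC
  set T : Set (R k × R k) := {r : R k | |(r : ℝ × ℝ).1| ≤ C ∧ |(r : ℝ × ℝ).2| ≤ C} ×ˢ
    {r : R k | |(r : ℝ × ℝ).1| ≤ C ∧ |(r : ℝ × ℝ).2| ≤ C} with hT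
  have hTf : T.Finite := (fin_R hk1 C).prod (fin_R hk1 C)
  have cy1 : Continuous y1 := by unfold y1; fun_prop
  have cy2 : Continuous y2 := by unfold y2; fun_prop
  have cx1 : Continuous x1 := by unfold x1; fun_prop
  have cx2 : Continuous x2 := by unfold x2; fun_prop
  have E0 : ∀ᶠ q in nhds p, ∀ cd ∈ T, (cd ∈ Spairs k ∧ cd.1 ≠ 0) →
      1 < HNorm (cd.1 : ℝ × ℝ) (cd.2 : ℝ × ℝ) q := by
    rw [Filter.eventually_all_finite hTf]
    rintro ⟨c, d⟩ -
    by_cases hcd : (c, d) ∈ Spairs k ∧ c ≠ 0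
    · filter_upwards [(cont_HNorm (c : ℝ × ℝ) (d : ℝ × ℝ)).continuousAt.eventually
        (lt_mem_nhds (h5 c d hcd.1 hcd.2))] with q hq _
      exact hq
    · exact Filter.Eventually.of_forall fun q h => absurd h hcd
  have hmy1 : m < y1 p := by
    have := min_le_left (y1 p) (y2 p); have := lt_min hp.1 hp.2; linarith
  have hmy2 : m < y2 p := by
    have := min_le_right (y1 p) (y2 p); have := lt_min hp.1 hp.2; linarith
  have hMx1 : |x1 p| < M := by have := le_max_left |x1 p| |x2 p|; linarith
  have hMx2 : |x2 p| < M := by have := le_max_right |x1 p| |x2 p|; linarith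
  filter_upwards [E0, open_HH.mem_nhds hp,
    (cont_s1 k).abs.continuousAt.eventually (gt_mem_nhds h1),
    (cont_s2 k).abs.continuousAt.eventually (gt_mem_nhds h2),
    (cont_rr hp).eventually (lt_mem_nhds h3), (cont_rr hp).eventually (gt_mem_nhds h4),
    cy1.continuousAt.eventually (lt_mem_nhds hmy1), cy2.continuousAt.eventually (lt_mem_nhds hmy2),
    cx1.abs.continuousAt.eventually (gt_mem_nhds hMx1),
    cx2.abs.continuousAt.eventually (gt_mem_nhds hMx2)]
    with q q0 qH qs1 qs2 qr1 qr2 qy1 qy2 qx1 qx2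
  refine ⟨⟨qH, qs1.le, qs2.le, qr1.le, qr2.le⟩, qH, ?_⟩
  rintro ⟨c, d⟩ hcd
  change 1 ≤ HNorm (c : ℝ × ℝ) (d : ℝ × ℝ) q
  by_cases hc : c = 0
  · subst hc
    obtain ⟨a, b, hab⟩ := (Spairs_iff _ _).1 hcd
    have hd : b * d = 1 := by simpa using hab
    have := HNorm_unit (Units.mkOfMulEqOne d b (by rw [mul_comm]; exact hd)) q
    exact this.ge
  by_contra hlt
  push Not at hlt
  have c1 : (c : ℝ × ℝ).1 ≠ 0 := fun h => hc (R_inj hk hk1 c (Or.inl h))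
  have c2 : (c : ℝ × ℝ).2 ≠ 0 := fun h => hc (R_inj hk hk1 c (Or.inr h))
  have q1 := qH.1
  have q2 := qH.2
  set A := ((c : ℝ × ℝ).1 * x1 q + (d : ℝ × ℝ).1) ^ 2 + (c : ℝ × ℝ).1 ^ 2 * y1 q ^ 2 with hA
  set B := ((c : ℝ × ℝ).2 * x2 q + (d : ℝ × ℝ).2) ^ 2 + (c : ℝ × ℝ).2 ^ 2 * y2 q ^ 2 with hB
  have hA0 : 0 < A := by positivity
  have hB0 : 0 < B := by positivity
  have hAB : A * B < 1 := hlt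
  obtain ⟨n, hn1, hn2⟩ := exists_mem_Ico_zpow hA0 (by nlinarith : 1 < eps k e ^ 2)
  set v : (R k)ˣ := e ^ (-n) with hv
  have hε0 : 0 < eps k e := by linarith
  have hv1 : (unitVal k v).1 ^ 2 = ((eps k e ^ 2) ^ n)⁻¹ := by
    rw [hv, unit_zpow]
    change (eps k e ^ (-n)) ^ 2 = _
    rw [zpow_neg, inv_pow, ← zpow_natCast, ← zpow_natCast, ← zpow_mul, ← zpow_mul, mul_comm]
  have hpn : 0 < (eps k e ^ 2) ^ n := by positivity
  have hA1 : 1 ≤ (unitVal k v).1 ^ 2 * A := by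
    rw [hv1, inv_mul_eq_div, le_div_iff₀ hpn, one_mul]; exact hn1
  have hA2 : (unitVal k v).1 ^ 2 * A ≤ eps k e ^ 2 := by
    rw [hv1, inv_mul_eq_div, div_le_iff₀ hpn]
    rw [zpow_add_one₀ (by positivity)] at hn2
    linarith
  have hvn := unit_norm v
  have hB2 : (unitVal k v).2 ^ 2 * B ≤ eps k e ^ 2 := by
    have t1 : ((unitVal k v).1 ^ 2 * A) * ((unitVal k v).2 ^ 2 * B) = A * B := by
      linear_combination (A * B) * hvn
    have t2 : 0 ≤ (unitVal k v).2 ^ 2 * B := by positivity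
    nlinarith
  have eqA : (unitVal k v).1 ^ 2 * A = (((unitVal k v).1 * (c : ℝ × ℝ).1) * x1 q +
      (unitVal k v).1 * (d : ℝ × ℝ).1) ^ 2 + ((unitVal k v).1 * (c : ℝ × ℝ).1) ^ 2 * y1 q ^ 2 := by
    rw [hA]; ring
  have eqB : (unitVal k v).2 ^ 2 * B = (((unitVal k v).2 * (c : ℝ × ℝ).2) * x2 q +
      (unitVal k v).2 * (d : ℝ × ℝ).2) ^ 2 + ((unitVal k v).2 * (c : ℝ × ℝ).2) ^ 2 * y2 q ^ 2 := by
    rw [hB]; ring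
  rw [eqA] at hA2
  rw [eqB] at hB2
  have b1 := bd hm0 qy1.le hε0 qx1.le hA2
  have b2 := bd hm0 qy2.le hε0 qx2.le hB2
  have hS := Spairs_smul v hcd
  have := q0 ((v : R k) * c, (v : R k) * d) ⟨⟨b1.1, b2.1⟩, ⟨b1.2, b2.2⟩⟩
    ⟨hS, fun h => hc ((Units.mul_right_eq_zero v).1 h)⟩
  simp only [HNorm_smul] at this
  linarith
lemma mem_of_t {k : ℕ} {ε : ℝ} {p : Pt} (hp : p ∈ F k ε) (t : SL k) (h1 : t ≠ 1)
    (h2 : t.1 ≠ -1) (h : act k t p ∈ F k ε) :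
    p ∈ ⋃ g ∈ {g : SL k | g ≠ 1 ∧ g.1 ≠ -1}, (F k ε ∩ act k g '' F k ε) := by
  simp only [Set.mem_iUnion]
  refine ⟨t⁻¹, ⟨inv_ne_one.2 h1, ?_⟩, hp, act k t p, h, ?_⟩
  · intro h0
    apply h2
    have h3 : t.1 * (t⁻¹).1 = 1 := by
      have := congrArg Subtype.val (mul_inv_cancel t)
      exact this
    rw [h0] at h3
    have h4 : -t.1 = 1 := by rw [← h3]; simp
    rw [← h4, neg_neg]
  · rw [← act_mul _ _ hp.1.1, inv_mul_cancel, act_one]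

/-- move into the strip -/
lemma reduce_s {k : ℕ} (hk1 : 1 < k) (d : (R k)ˣ) {p : Pt} (hp : p ∈ HH) :
    ∃ t : SL k, t.1 1 0 = 0 ∧ t.1 1 1 = d ∧ |s1 k (act k t p)| ≤ 1 / 2 ∧
      |s2 k (act k t p)| ≤ 1 / 2 ∧ rr (act k t p) = rr p / (unitVal k d).1 ^ 4 := by
  set q : Pt := (x1 p / (unitVal k d).1 ^ 2, x2 p / (unitVal k d).2 ^ 2,
        y1 p / (unitVal k d).1 ^ 2, y2 p / (unitVal k d).2 ^ 2) with hq
  obtain ⟨β, hb1, hb2⟩ := R_mk k (-round (s1 k q)) (-round (s2 k q))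
  obtain ⟨t, t1, t2, -, t3⟩ := actU d β
  obtain ⟨e1, e2⟩ := s_shift (p := q) (q := act k t p) hk1 (by rw [t3, ← hb1]; rfl)
    (by rw [t3, ← hb2]; rfl)
  refine ⟨t, t1, t2, ?_, ?_, ?_⟩
  · rw [e1]; push_cast; rw [← sub_eq_add_neg]; exact abs_sub_round _
  · rw [e2]; push_cast; rw [← sub_eq_add_neg]; exact abs_sub_round _
  · rw [t3]
    have hn := unit_norm d
    simp only [rr]
    change (y1 p / (unitVal k d).1 ^ 2) / (y2 p / (unitVal k d).2 ^ 2) = _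
    have n1 : (unitVal k d).1 ≠ 0 := by rintro h; rw [h] at hn; simp at hn
    have n2 : (unitVal k d).2 ≠ 0 := by rintro h; rw [h] at hn; simp at hn
    have n3 : y2 p ≠ 0 := hp.2.ne'
    rw [div_div_div_eq, div_div, div_eq_div_iff (by positivity) (by positivity)]
    linear_combination (y1 p * y2 p * (unitVal k d).1 ^ 2) * hn

lemma reduce {k : ℕ} (hk1 : 1 < k) (e : (R k)ˣ) (he : IsFundUnit k e) {p : Pt} (hp : p ∈ HH) :
    ∃ t : SL k, t.1 1 0 = 0 ∧ (∃ d : (R k)ˣ, t.1 1 1 = d) ∧ act k t p ∈ FInf k (eps k e) := by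
  have hε : 1 < eps k e := he.1
  have hε0 : 0 < eps k e := by linarith
  have hr : 0 < rr p := div_pos hp.1 hp.2
  obtain ⟨n, hn1, hn2⟩ := exists_mem_Ico_zpow (by positivity : 0 < rr p * eps k e ^ 2)
    (one_lt_pow₀ hε (by norm_num : 4 ≠ 0))
  obtain ⟨t, t1, t2, t3, t4, t5⟩ := reduce_s hk1 (e ^ n) hp
  have hv : (unitVal k (e ^ n)).1 ^ 4 = (eps k e ^ 4) ^ n := by
    rw [unit_zpow]
    change (eps k e ^ n) ^ 4 = _
    rw [← zpow_natCast, ← zpow_natCast, ← zpow_mul, ← zpow_mul, mul_comm]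
  have hpn : 0 < (eps k e ^ 4) ^ n := by positivity
  refine ⟨t, t1, ⟨_, t2⟩, act_HH t hp, t3, t4, ?_, ?_⟩
  · rw [t5, hv, le_div_iff₀ hpn, inv_mul_le_iff₀ (by positivity), mul_comm]; exact hn1
  · rw [t5, hv, div_le_iff₀ hpn]
    rw [zpow_add_one₀ (by positivity)] at hn2
    have : 0 < eps k e ^ 2 := by positivity
    nlinarith

lemma SL_ne {k : ℕ} (t : SL k) (h : (t.1 1 0 ≠ 0) ∨ (t.1 0 1 ≠ 0) ∨ (t.1 1 1 ≠ 1 ∧ t.1 1 1 ≠ -1)) :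
    t ≠ 1 ∧ t.1 ≠ -1 := by
  constructor
  · rintro rfl
    simp at h
  · intro h0
    rw [h0] at h
    simp at h

lemma act_U_F0 {k : ℕ} (t : SL k) (h : t.1 1 0 = 0) (d : (R k)ˣ) (hd : t.1 1 1 = d) {p : Pt}
    (hp : p ∈ F0 k) : act k t p ∈ F0 k := by
  apply act_F0 t hp
  rw [h, hd]; exact HNorm_unit d p

lemma sub1 {k : ℕ} (hk : Squarefree k) (hk1 : 1 < k) (e : (R k)ˣ) (he : IsFundUnit k e) {p : Pt}
    (hp : p ∈ F k (eps k e)) (hni : p ∉ interior (F k (eps k e))) :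
    ∃ t : SL k, (t ≠ 1 ∧ t.1 ≠ -1) ∧ act k t p ∈ F k (eps k e) := by
  have hε : 1 < eps k e := he.1
  have hε0 : 0 < eps k e := by linarith
  have hH := hp.1.1
  have hs1 := hp.1.2.1
  have hs2 := hp.1.2.2.1
  have hr1 := hp.1.2.2.2.1
  have hr2 := hp.1.2.2.2.2
  -- translations
  have trans : ∀ a b : ℤ, (a ≠ 0 ∨ b ≠ 0) → |s1 k p + a| ≤ 1 / 2 → |s2 k p + b| ≤ 1 / 2 →
      ∃ t : SL k, (t ≠ 1 ∧ t.1 ≠ -1) ∧ act k t p ∈ F k (eps k e) := by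
    intro a b hab h1 h2
    obtain ⟨β, hb1, hb2⟩ := R_mk k a b
    obtain ⟨t, t1, t2, t4, t3⟩ := actU 1 β
    have hu : unitVal k 1 = 1 := rfl
    have t3' := t3 p
    simp only [hu, Prod.fst_one, Prod.snd_one, one_pow, div_one] at t3'
    obtain ⟨e1, e2⟩ := s_shift (p := p) (q := act k t p) hk1 (by rw [t3', ← hb1]; rfl)
      (by rw [t3', ← hb2]; rfl)
    refine ⟨t, SL_ne t (Or.inr (Or.inl ?_)), ⟨act_HH t hH, by rw [e1]; exact h1,
      by rw [e2]; exact h2, by rw [t3']; exact hr1, by rw [t3']; exact hr2⟩,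
      act_U_F0 t t1 1 t2 hp.2⟩
    rw [t4, Units.val_one, one_mul]
    rintro rfl
    have := int_lin hk hk1 a b (Or.inl (by rw [← hb1]; rfl))
    omega
  have rot : ∀ d : (R k)ˣ, (d : R k) ≠ 1 → (d : R k) ≠ -1 →
      (eps k e ^ 2)⁻¹ ≤ rr p / (unitVal k d).1 ^ 4 → rr p / (unitVal k d).1 ^ 4 ≤ eps k e ^ 2 →
      ∃ t : SL k, (t ≠ 1 ∧ t.1 ≠ -1) ∧ act k t p ∈ F k (eps k e) := by
    intro d d1 d2 h1 h2
    obtain ⟨t, t1, t2, t3, t4, t5⟩ := reduce_s hk1 d hH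
    exact ⟨t, SL_ne t (Or.inr (Or.inr (by rw [t2]; exact ⟨d1, d2⟩))),
      ⟨act_HH t hH, t3, t4, by rw [t5]; exact h1, by rw [t5]; exact h2⟩, act_U_F0 t t1 d t2 hp.2⟩
  by_cases A1 : |s1 k p| < 1 / 2
  swap
  · push Not at A1
    rcases abs_cases (s1 k p) with h | h
    · exact trans (-1) 0 (by simp) (by push_cast; rw [abs_le]; constructor <;> linarith)
        (by simpa using hs2)
    · exact trans 1 0 (by simp) (by push_cast; rw [abs_le]; constructor <;> linarith)
        (by simpa using hs2)
  by_cases A2 : |s2 k p| < 1 / 2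
  swap
  · push Not at A2
    rcases abs_cases (s2 k p) with h | h
    · exact trans 0 (-1) (by simp) (by simpa using hs1)
        (by push_cast; rw [abs_le]; constructor <;> linarith)
    · exact trans 0 1 (by simp) (by simpa using hs1)
        (by push_cast; rw [abs_le]; constructor <;> linarith)
  have hd1 : (unitVal k e).1 = eps k e := rfl
  have hd2 : (unitVal k e⁻¹).1 = (eps k e)⁻¹ := by
    have := (unit_mul_inv e).1
    rw [hd1] at this
    exact eq_inv_of_mul_eq_one_right this
  have une : ∀ d : (R k)ˣ, 0 < (unitVal k d).1 → (unitVal k d).1 ≠ 1 →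
      (d : R k) ≠ 1 ∧ (d : R k) ≠ -1 := by
    intro d h1 h2
    constructor
    · intro h; apply h2; unfold unitVal; rw [h]; rfl
    · intro h; unfold unitVal at h1; rw [h] at h1
      have : (0 : ℝ) < -1 := h1
      linarith
  have hinv : (eps k e ^ 2)⁻¹ ≤ eps k e ^ 2 :=
    (inv_le_one_of_one_le₀ (one_le_pow₀ hε.le)).trans (one_le_pow₀ hε.le)
  by_cases A3 : (eps k e ^ 2)⁻¹ < rr p
  swap
  · have h0 : rr p = (eps k e ^ 2)⁻¹ := le_antisymm (not_lt.1 A3) hr1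
    have hi := une e⁻¹ (by rw [hd2]; positivity) (by rw [hd2]; exact (inv_lt_one_of_one_lt₀ hε).ne)
    have h9 : rr p / (unitVal k e⁻¹).1 ^ 4 = eps k e ^ 2 := by
      rw [h0, hd2]; field_simp
    exact rot e⁻¹ hi.1 hi.2 (by rw [h9]; exact hinv) h9.le
  by_cases A4 : rr p < eps k e ^ 2
  swap
  · have h0 : rr p = eps k e ^ 2 := le_antisymm hr2 (not_lt.1 A4)
    have hi := une e hε0 hε.ne'
    have h9 : rr p / (unitVal k e).1 ^ 4 = (eps k e ^ 2)⁻¹ := by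
      rw [h0, hd1]; field_simp
    exact rot e hi.1 hi.2 h9.ge (by rw [h9]; exact hinv)
  by_cases A5 : ∀ c d : R k, (c, d) ∈ Spairs k → c ≠ 0 → 1 < HNorm (c : ℝ × ℝ) (d : ℝ × ℝ) p
  · exact absurd (interior_of_strict hk hk1 e he hH A1 A2 A3 A4 A5) hni
  push Not at A5
  obtain ⟨c, d, hcd, hc, hle⟩ := A5
  have heq : HNorm (c : ℝ × ℝ) (d : ℝ × ℝ) p = 1 := le_antisymm hle (hp.2.2 _ hcd)
  obtain ⟨a, b, hab⟩ := (Spairs_iff _ _).1 hcd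
  let g : SL k := ⟨!![b, -a; c, d], by rw [Matrix.det_fin_two]; simp; linear_combination hab⟩
  have g1 : g.1 1 0 = c := rfl
  have g2 : g.1 1 1 = d := rfl
  have hg0 : act k g p ∈ F0 k := act_F0 g hp.2 (by rw [g1, g2]; exact heq)
  obtain ⟨t, t1, ⟨v, t2⟩, t3⟩ := reduce hk1 e he hg0.1
  refine ⟨t * g, SL_ne _ (Or.inl ?_), ?_⟩
  · have : (t * g).1 1 0 = t.1 1 0 * g.1 0 0 + t.1 1 1 * g.1 1 0 := by
      rw [Matrix.SpecialLinearGroup.coe_mul, Matrix.mul_apply, Fin.sum_univ_two]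
    rw [this, t1, t2, g1, zero_mul, zero_add]
    exact fun h => hc ((Units.mul_right_eq_zero v).1 h)
  · rw [act_mul _ _ hH]
    exact ⟨t3, act_U_F0 t t1 v t2 hg0⟩

lemma sub2 {k : ℕ} (hk : Squarefree k) (hk1 : 1 < k) (e : (R k)ˣ) (he : IsFundUnit k e) {q : Pt}
    (g : SL k) (hg1 : g ≠ 1) (hg2 : g.1 ≠ -1) (hq : q ∈ F k (eps k e))
    (hp : act k g q ∈ F k (eps k e)) : act k g q ∉ interior (F k (eps k e)) := by
  have hε : 1 < eps k e := he.1
  have hε0 : 0 < eps k e := by linarith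
  have hqH := hq.1.1
  have hpH := hp.1.1
  have hdet := g.2
  rw [Matrix.det_fin_two] at hdet
  by_cases hc : g.1 1 0 = 0
  · rw [hc, mul_zero, sub_zero] at hdet
    let d : (R k)ˣ := Units.mkOfMulEqOne (g.1 1 1) (g.1 0 0) (by rw [mul_comm]; exact hdet)
    have hd : (d : R k) = g.1 1 1 := rfl
    have hn := unit_norm d
    have e1 : y1 (act k g q) = y1 q / (unitVal k d).1 ^ 2 := by
      change y1 q / _ = _
      rw [hc]; simp [unitVal, hd]
    have e2 : y2 (act k g q) = y2 q / (unitVal k d).2 ^ 2 := by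
      change y2 q / _ = _
      rw [hc]; simp [unitVal, hd]
    have n1 : (unitVal k d).1 ≠ 0 := by rintro h; rw [h] at hn; simp at hn
    have n2 : (unitVal k d).2 ≠ 0 := by rintro h; rw [h] at hn; simp at hn
    have er : rr (act k g q) * (unitVal k d).1 ^ 4 = rr q := by
      unfold rr; rw [e1, e2]
      have := hqH.2
      field_simp
      linear_combination (y1 q) * hn
    have hr0 : 0 < rr (act k g q) := div_pos hpH.1 hpH.2
    have hr0' : 0 < rr q := div_pos hqH.1 hqH.2
    have hE : 0 < eps k e ^ 2 := by positivity
    by_cases hd1 : (d : R k) = 1 ∨ (d : R k) = -1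
    · have hb : g.1 0 1 ≠ 0 := by
        intro hb
        rcases hd1 with h | h
        · apply hg1
          rw [hd] at h
          apply Subtype.ext
          ext i j : 1
          rw [h, mul_one] at hdet
          fin_cases i <;> fin_cases j <;> simp_all
        · apply hg2
          rw [hd] at h
          ext i j : 1
          have h00 : g.1 0 0 = -1 := by rw [h] at hdet; linear_combination -hdet
          fin_cases i <;> fin_cases j <;> simp_all
      have had : g.1 0 0 = g.1 1 1 := by
        rw [hd] at hd1
        rcases hd1 with h | h <;> rw [h] at hdet ⊢
        · linear_combination hdet
        · linear_combination -hdet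
      have hdd : g.1 1 1 * g.1 1 1 = 1 := by rw [had] at hdet; exact hdet
      obtain ⟨a, b, ha, hb'⟩ := R_rep (g.1 0 1 * g.1 1 1)
      have k1 : (g.1 1 1 : ℝ × ℝ).1 * (g.1 1 1 : ℝ × ℝ).1 = 1 :=
        congrArg (fun r : R k => (r : ℝ × ℝ).1) hdd
      have k2 : (g.1 1 1 : ℝ × ℝ).2 * (g.1 1 1 : ℝ × ℝ).2 = 1 :=
        congrArg (fun r : R k => (r : ℝ × ℝ).2) hdd
      have f1 : x1 (act k g q) = x1 q + (a + b * omg k) := by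
        rw [← ha]
        change (_ / _ : ℝ) = _ + (g.1 0 1 : ℝ × ℝ).1 * (g.1 1 1 : ℝ × ℝ).1
        rw [hc, had]
        simp [pow_two, k1]
        linear_combination (x1 q) * k1
      have f2 : x2 (act k g q) = x2 q + (a + b * omg' k) := by
        rw [← hb']
        change (_ / _ : ℝ) = _ + (g.1 0 1 : ℝ × ℝ).2 * (g.1 1 1 : ℝ × ℝ).2
        rw [hc, had]
        simp [pow_two, k2]
        linear_combination (x2 q) * k2
      obtain ⟨s1e, s2e⟩ := s_shift hk1 f1 f2
      apply not_int_s hk1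
      have aux : ∀ (x y : ℝ) (n : ℤ), n ≠ 0 → y = x + n → |x| ≤ 1 / 2 → |y| ≤ 1 / 2 →
          |y| = 1 / 2 := by
        intro x y n hn hy h1 h2
        refine le_antisymm h2 ?_
        rcases lt_or_gt_of_ne hn with h | h
        · have : (n : ℝ) ≤ -1 := by exact_mod_cast (by omega : n ≤ -1)
          rw [abs_le] at h1
          have := neg_abs_le y
          linarith
        · have : (1 : ℝ) ≤ n := by exact_mod_cast (by omega : 1 ≤ n)
          rw [abs_le] at h1
          have := le_abs_self y
          linarith
      by_cases ha0 : a = 0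
      · by_cases hb0 : b = 0
        · exfalso
          have h0 : g.1 0 1 * g.1 1 1 = 0 := R_inj hk hk1 _ (Or.inl (by rw [ha, ha0, hb0]; simp))
          apply hb
          linear_combination (g.1 1 1) * h0 - (g.1 0 1) * hdd
        · right; exact aux _ _ b hb0 s2e hq.1.2.2.1 hp.1.2.2.1
      · left; exact aux _ _ a ha0 s1e hq.1.2.1 hp.1.2.1
    · push Not at hd1
      apply not_int_r hpH
      rcases unit_big hk hk1 e he d hd1.1 hd1.2 with h | h
      · right
        refine le_antisymm ?_ hp.1.2.2.2.1
        rw [← one_div, le_div_iff₀ hE]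
        have h4 : (eps k e ^ 2) ^ 2 ≤ (unitVal k d).1 ^ 4 := by
          calc _ ≤ ((unitVal k d).1 ^ 2) ^ 2 := by gcongr
            _ = _ := by ring
        have h5 := hq.1.2.2.2.2
        have h6 : rr (act k g q) * (eps k e ^ 2) ^ 2 ≤ eps k e ^ 2 := by
          calc _ ≤ rr (act k g q) * (unitVal k d).1 ^ 4 := by gcongr
            _ ≤ _ := by rw [er]; exact h5
        nlinarith
      · left
        refine le_antisymm hp.1.2.2.2.2 ?_
        have er' : rr (act k g q) = rr q * (unitVal k d).2 ^ 4 := by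
          rw [← er]
          linear_combination (-rr (act k g q) *
            ((unitVal k d).1 ^ 2 * (unitVal k d).2 ^ 2 + 1)) * hn
        have h4 : (eps k e ^ 2) ^ 2 ≤ (unitVal k d).2 ^ 4 := by
          calc _ ≤ ((unitVal k d).2 ^ 2) ^ 2 := by gcongr
            _ = _ := by ring
        have h5 := hq.1.2.2.2.1
        rw [er']
        calc eps k e ^ 2 = (eps k e ^ 2)⁻¹ * (eps k e ^ 2) ^ 2 := by field_simp
          _ ≤ _ := by gcongr
  · have h1 := HNorm_act g hqH (-g.1 1 0) (g.1 0 0)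
    have z1 : -g.1 1 0 * g.1 0 0 + g.1 0 0 * g.1 1 0 = 0 := by ring
    have z2 : -g.1 1 0 * g.1 0 1 + g.1 0 0 * g.1 1 1 = ((1 : (R k)ˣ) : R k) := by
      rw [Units.val_one]; linear_combination hdet
    rw [z1, z2, HNorm_unit] at h1
    have h2 := hq.2.2 _ (Spairs_row g)
    have hS : (-g.1 1 0, g.1 0 0) ∈ Spairs k := by
      rw [Spairs_iff]; exact ⟨g.1 0 1, g.1 1 1, by linear_combination hdet⟩
    have h3 := hp.2.2 _ hS
    refine not_int_n hk hk1 hpH (neg_ne_zero.2 hc) hS ?_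
    simp only at h2 h3
    nlinarith

/-- The boundary of `F` in `H²×H²` equals `⋃_{g ∈ Γ, g ≠ 1} (F ∩ g(F))`
(elements `g ≠ 1` of `Γ = PSL₂(R)` correspond to `g ≠ ±1` in `SL₂(R)`). -/
theorem frontier_F_eq_union (k : ℕ) (hk : Squarefree k) (hk1 : 1 < k)
    (e : (R k)ˣ) (he : IsFundUnit k e) :
    frontier (F k (eps k e)) ∩ HH =
      ⋃ g ∈ {g : SL k | g ≠ 1 ∧ g.1 ≠ -1},
        (F k (eps k e) ∩ act k g '' F k (eps k e)) := by
  ext p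
  constructor
  · rintro ⟨hfr, hpH⟩
    have hp := closed_F hpH hfr.1
    obtain ⟨t, ⟨t1, t2⟩, t3⟩ := sub1 hk hk1 e he hp hfr.2
    exact mem_of_t hp t t1 t2 t3
  · intro h
    simp only [Set.mem_iUnion] at h
    obtain ⟨g, ⟨hg1, hg2⟩, hp, q, hq, rfl⟩ := h
    exact ⟨⟨subset_closure hp, sub2 hk hk1 e he g hg1 hg2 hq hp⟩, hp.1.1⟩

end Hilbert
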